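/- Let a, b, c be linearly independent unit vectors in ℝ³ with ⟪a,b⟫ = ⟪a,c⟫ = ⟪b,c⟫ = z for some real z with 1/2 < z < 1 (an equilateral configuration with common angle φ = arccos z strictly less than 60°), and let e = (a + b + c) / ‖a + b + c‖. Then the set of minimizers of J over the unit sphere is exactly {e, -e}. -/

import Mathlib

open RealInnerProductSpace

noncomputable def dS (x y : EuclideanSpace ℝ (Fin 3)) : ℝ := Real.sqrt (1 - ⟪x, y⟫ ^ 2)

noncomputable def J (a b c p : EuclideanSpace ℝ (Fin 3)) : ℝ := dS a p + dS b p + dS c p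

def IsMinimizer (a b c p : EuclideanSpace ℝ (Fin 3)) : Prop :=
  ‖p‖ = 1 ∧ ∀ q : EuclideanSpace ℝ (Fin 3), ‖q‖ = 1 → J a b c p ≤ J a b c q

lemma phi_big (r s t : ℝ) (hr : 1/2 ≤ r) (hr1 : r < 1) (hs : 0 ≤ s) (ht : 0 ≤ t)
    (h : r + s + t = 1) :
    0 < (1-3*r)^2*(1-2*r)/(1+r) + (1-3*s)^2*(1-2*s)/(1+s) + (1-3*t)^2*(1-2*t)/(1+t) := by
  have key : ∀ x : ℝ, 0 ≤ x → (1-3*x)^2*(1-2*x)/(1+x) = 48/(1+x) - 18*x^2+39*x-47 := by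
    intro x hx
    have : (1+x) ≠ 0 := by positivity
    field_simp
    ring
  have h1 : (1-3*r)^2*(1-2*r)/(1+r) + (3*r-1)^2*r/(3-r) = (3*r-1)^2*(3*(1-r)^2)/((1+r)*(3-r)) := by
    have : (1+r) ≠ 0 := by positivity
    have : (3-r) ≠ 0 := by linarith
    field_simp
    ring
  have h1' : 0 < (3*r-1)^2*(3*(1-r)^2)/((1+r)*(3-r)) := by
    have : 0 < 3*r-1 := by linarith
    have : 0 < 1-r := by linarith
    have : 0 < 3-r := by linarith
    positivity
  have h2 : (3*r-1)^2*r/(3-r) ≤ (1-3*s)^2*(1-2*s)/(1+s) + (1-3*t)^2*(1-2*t)/(1+t) := by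
    have hid : (1-3*s)^2*(1-2*s)/(1+s) + (1-3*t)^2*(1-2*t)/(1+t) - (3*r-1)^2*r/(3-r)
        = (s-t)^2 * (48/((1+s)*(1+t)*(3-r)) - 9) := by
      obtain rfl : r = 1 - s - t := by linarith
      have : (1+s) ≠ 0 := by positivity
      have : (1+t) ≠ 0 := by positivity
      have : (3-(1-s-t)) ≠ 0 := by linarith
      field_simp
      ring
    have hp : (1+s)*(1+t)*(3-r) ≤ 48/9 := by
      have a1 : (1+s)*(1+t) ≤ 25/16 := by nlinarith [sq_nonneg (s-t)]
      have a2 : 0 ≤ (1+s)*(1+t) := by positivity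
      nlinarith
    have hpp : 0 < (1+s)*(1+t)*(3-r) := by
      have : 0 < 3 - r := by linarith
      positivity
    have : 9 ≤ 48/((1+s)*(1+t)*(3-r)) := by
      rw [le_div_iff₀ hpp]; linarith
    have : 0 ≤ (s-t)^2 * (48/((1+s)*(1+t)*(3-r)) - 9) :=
      mul_nonneg (sq_nonneg _) (by linarith)
    linarith
  linarith

lemma phi_pos (r s t : ℝ) (hr : 0 < r) (hs : 0 < s) (ht : 0 < t)
    (h : r + s + t = 1) (hne : ¬ (r = s ∧ s = t)) :
    0 < (1-3*r)^2*(1-2*r)/(1+r) + (1-3*s)^2*(1-2*s)/(1+s) + (1-3*t)^2*(1-2*t)/(1+t) := by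
  by_cases h1 : 1/2 ≤ r
  · exact phi_big r s t h1 (by linarith) hs.le ht.le h
  by_cases h2 : 1/2 ≤ s
  · have := phi_big s r t h2 (by linarith) hr.le ht.le (by linarith)
    linarith
  by_cases h3 : 1/2 ≤ t
  · have := phi_big t r s h3 (by linarith) hr.le hs.le (by linarith)
    linarith
  push Not at h1 h2 h3
  have nn : ∀ x : ℝ, 0 < x → x < 1/2 → 0 ≤ (1-3*x)^2*(1-2*x)/(1+x) := by
    intro x hx hx'
    have : 0 < 1 - 2*x := by linarith
    positivity
  have pp : ∀ x : ℝ, 0 < x → x < 1/2 → x ≠ 1/3 → 0 < (1-3*x)^2*(1-2*x)/(1+x) := by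
    intro x hx hx' hn
    have : 0 < 1 - 2*x := by linarith
    have : 1 - 3*x ≠ 0 := fun hh => hn (by linarith)
    positivity
  have n1 := nn r hr h1
  have n2 := nn s hs h2
  have n3 := nn t ht h3
  by_cases e1 : r = 1/3
  · by_cases e2 : s = 1/3
    · exact absurd ⟨by linarith, by linarith⟩ hne
    · have := pp s hs h2 e2
      linarith
  · have := pp r hr h1 e1
    linarith

/-- one-term lower bound -/
lemma term_bound (M v : ℝ) (hM : M ≤ 3) (hv : 0 ≤ v) (hv2 : v < 1/2) :
    M * ((3*v-1)^2*(4*v-1)/(1-v)) ≤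
      M * ((3*v-1)^2*((2*(9-M)*v-3)/(3-M*v))) ∨ M < 0 := by
  by_cases h0 : M < 0
  · exact Or.inr h0
  left
  push Not at h0
  have a1 : 0 < 1 - v := by linarith
  have a2 : 0 < 3 - M*v := by nlinarith
  apply mul_le_mul_of_nonneg_left _ h0
  rw [mul_div_assoc]
  apply mul_le_mul_of_nonneg_left _ (sq_nonneg _)
  rw [div_le_div_iff₀ a1 a2]
  have : 0 ≤ 3*(3-M)*v*(1-2*v) := by
    have : 0 ≤ 3 - M := by linarith
    have : 0 ≤ 1 - 2*v := by linarith
    positivity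
  nlinarith

lemma cs3 (x y w p q r : ℝ) (hp : 0 < p) (hq : 0 < q) (hr : 0 < r) :
    (x+y+w)^2 ≤ (p+q+r)*(x^2/p + y^2/q + w^2/r) := by
  have e : (p+q+r)*(x^2/p + y^2/q + w^2/r) - (x+y+w)^2 =
      (q*x-p*y)^2/(p*q) + (r*x-p*w)^2/(p*r) + (r*y-q*w)^2/(q*r) := by
    field_simp
    ring
  have : 0 ≤ (q*x-p*y)^2/(p*q) + (r*x-p*w)^2/(p*r) + (r*y-q*w)^2/(q*r) := by positivity
  linarith

lemma real_core (x y w v1 v2 v3 M z : ℝ) (hM : 0 < M) (hMz : M ≤ 6*(1-z)) (hz : 1/2 < z)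
    (hz1 : z < 1)
    (p1 : 0 < v1) (p2 : 0 < v2) (p3 : 0 < v3)
    (q1 : v1 < 1/2) (q2 : v2 < 1/2) (q3 : v3 < 1/2) (hs : v1 + v2 + v3 = 1)
    (hx : x^2 = 1 - M*v1^2) (hy : y^2 = 1 - M*v2^2) (hw : w^2 = 1 - M*v3^2)
    (hc : (1+2*z)*(2+z) ≤ (1+2*z)*(M*(v1^2+v2^2+v3^2)) + z*(x+y+w)^2) :
    v1 = v2 ∧ v2 = v3 := by
  by_contra hne
  have hM3 : M < 3 := by linarith
  have b1 : 0 < 3 - M*v1 := by nlinarith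
  have b2 : 0 < 3 - M*v2 := by nlinarith
  have b3 : 0 < 3 - M*v3 := by nlinarith
  -- Cauchy-Schwarz
  have hCS : (x+y+w)^2 ≤ (9-M)*(x^2/(3-M*v1) + y^2/(3-M*v2) + w^2/(3-M*v3)) := by
    have h := cs3 x y w _ _ _ b1 b2 b3
    have e : (3-M*v1) + (3-M*v2) + (3-M*v3) = 9 - M := by linear_combination (-M)*hs
    rwa [e] at h
  have hterm : ∀ v : ℝ, 0 < 3 - M*v → (9-M)*((1-M*v^2)/(3-M*v)) =
      (9-M)/3 - M*(v-1/3) - 9*M*((v-1/3)^2/(3-M*v)) := by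
    intro v hv
    have := hv.ne'
    field_simp
    ring
  obtain ⟨D, hD⟩ : ∃ D, D = (v1-1/3)^2/(3-M*v1) + (v2-1/3)^2/(3-M*v2) + (v3-1/3)^2/(3-M*v3) :=
    ⟨_, rfl⟩
  obtain ⟨B, hB⟩ : ∃ B, B = (v1-1/3)^2 + (v2-1/3)^2 + (v3-1/3)^2 := ⟨_, rfl⟩
  have hT : (x+y+w)^2 ≤ 9 - M - 9*M*D := by
    refine hCS.trans (le_of_eq ?_)
    rw [hx, hy, hw, mul_add, mul_add, hterm _ b1, hterm _ b2, hterm _ b3, hD]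
    linear_combination (-M)*hs
  have hV : v1^2+v2^2+v3^2 = 1/3 + B := by
    rw [hB]; linear_combination (2/3)*hs
  have hB6 : B ≤ 1/6 := by
    have c1 : v1^2 ≤ v1*(1/2) := by nlinarith only [p1, q1]
    have c2 : v2^2 ≤ v2*(1/2) := by nlinarith only [p2, q2]
    have c3 : v3^2 ≤ v3*(1/2) := by nlinarith only [p3, q3]
    linarith only [c1, c2, c3, hV, hs]
  have hphi := phi_pos (1-2*v1) (1-2*v2) (1-2*v3) (by linarith) (by linarith) (by linarith)
    (by linarith) (fun h => hne ⟨by linarith [h.1], by linarith [h.2]⟩)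
  have conv : ∀ v : ℝ, 0 < v → v < 1/2 →
      (1-3*(1-2*v))^2*(1-2*(1-2*v))/(1+(1-2*v)) = 2*((3*v-1)^2*(4*v-1)/(1-v)) := by
    intro v _ hv
    have : (1 - v) ≠ 0 := by linarith
    have : (1 + (1-2*v)) ≠ 0 := by linarith
    field_simp
    ring
  rw [conv _ p1 q1, conv _ p2 q2, conv _ p3 q3] at hphi
  have tb : ∀ v : ℝ, 0 < v → v < 1/2 → 0 < 3 - M*v →
      M * ((3*v-1)^2*(4*v-1)/(1-v)) ≤
      9*(9*(6-M)*((v-1/3)^2/(3-M*v)) - 2*(9-M)*(v-1/3)^2) := by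
    intro v hv hv' hb
    rcases term_bound M v hM3.le hv.le hv' with h | h
    · refine h.trans (le_of_eq ?_)
      have := hb.ne'
      field_simp
      ring
    · linarith
  have t1 := tb _ p1 q1 b1
  have t2 := tb _ p2 q2 b2
  have t3 := tb _ p3 q3 b3
  have hKD : 0 < 9*(6-M)*D - 2*(9-M)*B := by
    have hm := mul_pos hM hphi
    rw [hD, hB]
    linarith
  rw [hV] at hc
  have hQ : (1-z)*(6*(1-z)-M)/3 - M*((1+2*z)*B - 9*z*D) ≤ 0 := by
    have := mul_le_mul_of_nonneg_left hT (by linarith : (0:ℝ) ≤ z)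
    linarith
  have hB0 : 0 ≤ B := by rw [hB]; positivity
  -- multiply by (6-M)
  have hpos : 0 < (6-M)*((1-z)*(6*(1-z)-M)/3 - M*((1+2*z)*B - 9*z*D)) := by
    have e1 : (6-M)*((1-z)*(6*(1-z)-M)/3 - M*((1+2*z)*B - 9*z*D)) =
      (6*(1-z)-M)*((6-M)*(1-z)/3 - M*B) + M*z*(9*(6-M)*D - 2*(9-M)*B) := by ring
    rw [e1]
    have : 0 < M*z*(9*(6-M)*D - 2*(9-M)*B) := by positivity
    have : 0 ≤ (6*(1-z)-M)*((6-M)*(1-z)/3 - M*B) := by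
      apply mul_nonneg (by linarith)
      have d1 : M*B ≤ M*(1/6) := mul_le_mul_of_nonneg_left hB6 hM.le
      have d2 : 3*(1-z) ≤ (6-M)*(1-z) := mul_le_mul_of_nonneg_right (by linarith) (by linarith)
      linarith only [d1, d2, hMz]
    linarith
  have := mul_nonneg (by linarith : 0 ≤ 6 - M) (neg_nonneg.2 hQ)
  linarith

lemma dS_sq (a p : EuclideanSpace ℝ (Fin 3)) (ha : ‖a‖ = 1) (hp : ‖p‖ = 1) :
    dS a p ^ 2 = 1 - ⟪a, p⟫ ^ 2 := by
  have h := abs_real_inner_le_norm a p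
  rw [ha, hp, one_mul] at h
  have h2 := abs_le.1 h
  exact Real.sq_sqrt (by nlinarith)

lemma dS_nonneg (a p : EuclideanSpace ℝ (Fin 3)) : 0 ≤ dS a p := Real.sqrt_nonneg _

lemma dS_eq_norm (a p : EuclideanSpace ℝ (Fin 3)) (ha : ‖a‖ = 1) (hp : ‖p‖ = 1) :
    dS a p = ‖a - ⟪a, p⟫ • p‖ := by
  rw [← sq_eq_sq₀ (dS_nonneg _ _) (norm_nonneg _), dS_sq a p ha hp, norm_sub_sq_real,
    inner_smul_right, norm_smul, ha, hp, Real.norm_eq_abs, mul_one, sq_abs]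
  ring

lemma dS_comm (a p : EuclideanSpace ℝ (Fin 3)) : dS a p = dS p a := by
  unfold dS
  rw [real_inner_comm]

lemma dS_le_norm (a b : EuclideanSpace ℝ (Fin 3)) (ha : ‖a‖ = 1) (hb : ‖b‖ = 1) (t : ℝ) :
    dS a b ≤ ‖a - t • b‖ := by
  rw [← sq_le_sq₀ (dS_nonneg _ _) (norm_nonneg _), dS_sq a b ha hb, norm_sub_sq_real,
    inner_smul_right, norm_smul, ha, hb, Real.norm_eq_abs, mul_one, sq_abs]
  nlinarith [sq_nonneg (t - ⟪a, b⟫)]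

lemma dS_triangle (a b p : EuclideanSpace ℝ (Fin 3)) (ha : ‖a‖ = 1) (hb : ‖b‖ = 1)
    (hp : ‖p‖ = 1) : dS a b ≤ dS a p + dS b p := by
  have h1 := dS_le_norm a b ha hb (⟪a, p⟫ * ⟪p, b⟫)
  have h2 : a - (⟪a, p⟫ * ⟪p, b⟫) • b = (a - ⟪a, p⟫ • p) + ⟪a, p⟫ • (p - ⟪p, b⟫ • b) := by
    rw [smul_sub, smul_smul]; abel
  rw [h2] at h1
  have h3 := norm_add_le (a - ⟪a, p⟫ • p) (⟪a, p⟫ • (p - ⟪p, b⟫ • b))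
  rw [norm_smul, ← dS_eq_norm a p ha hp, ← dS_eq_norm p b hp hb, dS_comm p b,
    Real.norm_eq_abs] at h3
  have h4 := abs_real_inner_le_norm a p
  rw [ha, hp, one_mul] at h4
  have h5 := mul_le_mul_of_nonneg_right h4 (dS_nonneg b p)
  linarith

lemma bessel (a b c p : EuclideanSpace ℝ (Fin 3)) (z : ℝ)
    (ha : ‖a‖ = 1) (hb : ‖b‖ = 1) (hc : ‖c‖ = 1) (hp : ‖p‖ = 1)
    (hab : ⟪a, b⟫ = z) (hac : ⟪a, c⟫ = z) (hbc : ⟪b, c⟫ = z)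
    (hz0 : 1 / 2 < z) (hz1 : z < 1) :
    (1+2*z)*(⟪a, p⟫^2 + ⟪b, p⟫^2 + ⟪c, p⟫^2) - z*(⟪a, p⟫+⟪b, p⟫+⟪c, p⟫)^2
      ≤ (1-z)*(1+2*z) := by
  obtain ⟨x, hx⟩ : ∃ x, x = ⟪a, p⟫ := ⟨_, rfl⟩
  obtain ⟨y, hy⟩ : ∃ y, y = ⟪b, p⟫ := ⟨_, rfl⟩
  obtain ⟨w, hw⟩ : ∃ w, w = ⟪c, p⟫ := ⟨_, rfl⟩
  have hba : ⟪b, a⟫ = z := by rw [real_inner_comm]; exact hab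
  have hca : ⟪c, a⟫ = z := by rw [real_inner_comm]; exact hac
  have hcb : ⟪c, b⟫ = z := by rw [real_inner_comm]; exact hbc
  have hpa : ⟪p, a⟫ = x := by rw [real_inner_comm]; exact hx.symm
  have hpb : ⟪p, b⟫ = y := by rw [real_inner_comm]; exact hy.symm
  have hpc : ⟪p, c⟫ = w := by rw [real_inner_comm]; exact hw.symm
  have haa : ⟪a, a⟫ = (1:ℝ) := by rw [real_inner_self_eq_norm_sq, ha]; norm_num
  have hbb : ⟪b, b⟫ = (1:ℝ) := by rw [real_inner_self_eq_norm_sq, hb]; norm_num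
  have hcc : ⟪c, c⟫ = (1:ℝ) := by rw [real_inner_self_eq_norm_sq, hc]; norm_num
  have hpp : ⟪p, p⟫ = (1:ℝ) := by rw [real_inner_self_eq_norm_sq, hp]; norm_num
  obtain ⟨N, hN⟩ : ∃ N, N = (1-z)*(1+2*z) := ⟨_, rfl⟩
  obtain ⟨α, hα⟩ : ∃ α, α = (1+2*z)*x - z*(x+y+w) := ⟨_, rfl⟩
  obtain ⟨β, hβ⟩ : ∃ β, β = (1+2*z)*y - z*(x+y+w) := ⟨_, rfl⟩
  obtain ⟨γ, hγ⟩ : ∃ γ, γ = (1+2*z)*w - z*(x+y+w) := ⟨_, rfl⟩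
  have h0 : (0:ℝ) ≤ ⟪N • p - (α • a + β • b + γ • c), N • p - (α • a + β • b + γ • c)⟫ :=
    real_inner_self_nonneg
  simp only [inner_sub_left, inner_sub_right, inner_add_left, inner_add_right,
    real_inner_smul_left, real_inner_smul_right, hab, hac, hbc, hba, hca, hcb, hpa, hpb, hpc,
    haa, hbb, hcc, hpp, ← hx, ← hy, ← hw] at h0
  rw [← hx, ← hy, ← hw]
  have hNpos : 0 < N := by
    rw [hN]
    have : 0 < 1 - z := by linarith
    positivity
  have h1 : 0 ≤ N * ((1-z)*(1+2*z) - ((1+2*z)*(x^2+y^2+w^2) - z*(x+y+w)^2)) := by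
    refine h0.trans (le_of_eq ?_)
    rw [hN, hα, hβ, hγ]
    ring
  have := nonneg_of_mul_nonneg_right h1 hNpos
  linarith

lemma key (a b c p : EuclideanSpace ℝ (Fin 3)) (z : ℝ)
    (ha : ‖a‖ = 1) (hb : ‖b‖ = 1) (hc : ‖c‖ = 1) (hp : ‖p‖ = 1)
    (hab : ⟪a, b⟫ = z) (hac : ⟪a, c⟫ = z) (hbc : ⟪b, c⟫ = z)
    (hz0 : 1 / 2 < z) (hz1 : z < 1) (hJ : J a b c p ^ 2 ≤ 6*(1-z)) :
    3*(1+2*z) ≤ (⟪a, p⟫+⟪b, p⟫+⟪c, p⟫)^2 := by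
  have hbes := bessel a b c p z ha hb hc hp hab hac hbc hz0 hz1
  have t1 := dS_triangle a b p ha hb hp
  have t2 := dS_triangle a c p ha hc hp
  have t3 := dS_triangle b c p hb hc hp
  have s1 := dS_sq a b ha hb
  have s2 := dS_sq a c ha hc
  have s3 := dS_sq b c hb hc
  rw [hab] at s1
  rw [hac] at s2
  rw [hbc] at s3
  have n1 := dS_nonneg a b
  have n2 := dS_nonneg a c
  have n3 := dS_nonneg b c
  have hx := dS_sq a p ha hp
  have hy := dS_sq b p hb hp
  have hw := dS_sq c p hc hp
  have k1 := dS_nonneg a p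
  have k2 := dS_nonneg b p
  have k3 := dS_nonneg c p
  unfold J at hJ
  generalize dS a p = u1 at *
  generalize dS b p = u2 at *
  generalize dS c p = u3 at *
  generalize ⟪a, p⟫ = x at *
  generalize ⟪b, p⟫ = y at *
  generalize ⟪c, p⟫ = w at *
  have tri : ∀ d m : ℝ, 0 ≤ d → d^2 = 1 - z^2 → 0 ≤ m → m^2 ≤ 6*(1-z) → m < 2*d := by
    intro d m hd hd2 hm hm2
    by_contra hcon
    push Not at hcon
    have : (2*d)^2 ≤ m^2 := pow_le_pow_left₀ (by linarith) hcon 2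
    nlinarith
  have m0 : 0 ≤ u1+u2+u3 := by positivity
  have r1 := tri _ _ n1 s1 m0 hJ
  have r2 := tri _ _ n2 s2 m0 hJ
  have r3 := tri _ _ n3 s3 m0 hJ
  have g3 : u3 < u1 + u2 := by linarith
  have g2 : u2 < u1 + u3 := by linarith
  have g1 : u1 < u2 + u3 := by linarith
  obtain ⟨m, hm⟩ : ∃ m, m = u1 + u2 + u3 := ⟨_, rfl⟩
  have hmpos : 0 < m := by linarith
  have sc : ∀ u : ℝ, m^2*(u/m)^2 = u^2 := by
    intro u
    field_simp
  rw [← hm] at hJ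
  have hcore := real_core x y w (u1/m) (u2/m) (u3/m) (m^2) z (by positivity) hJ hz0 hz1
    (div_pos (by linarith) hmpos) (div_pos (by linarith) hmpos) (div_pos (by linarith) hmpos)
    (by rw [div_lt_iff₀ hmpos]; linarith) (by rw [div_lt_iff₀ hmpos]; linarith)
    (by rw [div_lt_iff₀ hmpos]; linarith) (by rw [← add_div, ← add_div, ← hm, div_self hmpos.ne'])
    (by rw [sc]; linarith) (by rw [sc]; linarith) (by rw [sc]; linarith)
    (by
      have es : m^2*((u1/m)^2+(u2/m)^2+(u3/m)^2) = u1^2+u2^2+u3^2 := by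
        rw [mul_add, mul_add, sc, sc, sc]
      rw [es, hx, hy, hw]
      linarith)
  have e1 : u1 = u2 := (div_left_inj' hmpos.ne').1 hcore.1
  have e2 : u2 = u3 := (div_left_inj' hmpos.ne').1 hcore.2
  subst e1 e2
  have hU : 9*u1^2 ≤ 6*(1-z) := by rw [hm] at hJ; linarith
  have hT : (x+y+w)^2 ≤ 3*(x^2+y^2+w^2) := by
    linarith [sq_nonneg (x-y), sq_nonneg (x-w), sq_nonneg (y-w)]
  have hq : x^2+y^2+w^2 = 3 - 3*u1^2 := by linarith
  rw [hq] at hbes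
  -- z T ≥ (1+2z)(2 + z - 3u²)
  have h1 : (1+2*z)*(3-3*u1^2-(1-z)) ≤ z*(x+y+w)^2 := by linarith
  have h2 : (1+2*z)*(3*z) ≤ (1+2*z)*(3-3*u1^2-(1-z)) :=
    mul_le_mul_of_nonneg_left (by linarith) (by linarith)
  have h3 : z*(3*(1+2*z)) ≤ z*(x+y+w)^2 := by linarith
  exact le_of_mul_le_mul_left h3 (by linarith)

theorem stmt4 (a b c : EuclideanSpace ℝ (Fin 3)) (z : ℝ)
    (ha : ‖a‖ = 1) (hb : ‖b‖ = 1) (hc : ‖c‖ = 1)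
    (hli : LinearIndependent ℝ ![a, b, c])
    (hab : ⟪a, b⟫ = z) (hac : ⟪a, c⟫ = z) (hbc : ⟪b, c⟫ = z)
    (hz0 : 1 / 2 < z) (hz1 : z < 1)
    (e : EuclideanSpace ℝ (Fin 3)) (he : e = ‖a + b + c‖⁻¹ • (a + b + c)) :
    {p : EuclideanSpace ℝ (Fin 3) | IsMinimizer a b c p} = {e, -e} := by
  have hba : ⟪b, a⟫ = z := by rw [real_inner_comm]; exact hab
  have hca : ⟪c, a⟫ = z := by rw [real_inner_comm]; exact hac
  have hcb : ⟪c, b⟫ = z := by rw [real_inner_comm]; exact hbc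
  have haa : ⟪a, a⟫ = (1:ℝ) := by rw [real_inner_self_eq_norm_sq, ha]; norm_num
  have hbb : ⟪b, b⟫ = (1:ℝ) := by rw [real_inner_self_eq_norm_sq, hb]; norm_num
  have hcc : ⟪c, c⟫ = (1:ℝ) := by rw [real_inner_self_eq_norm_sq, hc]; norm_num
  have hn2 : ‖a + b + c‖^2 = 3*(1+2*z) := by
    rw [← real_inner_self_eq_norm_sq]
    simp only [inner_add_left, inner_add_right, hab, hac, hbc, hba, hca, hcb, haa, hbb, hcc]
    ring
  obtain ⟨n, hn⟩ : ∃ n, n = ‖a + b + c‖ := ⟨_, rfl⟩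
  rw [← hn] at hn2 he
  have hn0 : 0 < n := by
    have : 0 ≤ n := by rw [hn]; exact norm_nonneg _
    rcases this.eq_or_lt with h | h
    · rw [← h] at hn2; linarith
    · exact h
  have hen : ‖e‖ = 1 := by
    rw [he, norm_smul, ← hn, norm_inv, Real.norm_of_nonneg hn0.le]
    exact inv_mul_cancel₀ hn0.ne'
  have ine : ∀ v : EuclideanSpace ℝ (Fin 3), ⟪v, a⟫ + ⟪v, b⟫ + ⟪v, c⟫ = 1 + 2*z →
      dS v e = Real.sqrt (2/3*(1-z)) := by
    intro v hv
    unfold dS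
    congr 1
    rw [he, real_inner_smul_right, inner_add_right, inner_add_right, hv, mul_pow, inv_pow, hn2]
    have : 1 + 2*z ≠ 0 := by linarith
    field_simp
    ring
  have hJe : J a b c e ^ 2 = 6*(1-z) := by
    unfold J
    rw [ine a (by rw [haa, hab, hac]; ring), ine b (by rw [hba, hbb, hbc]; ring),
      ine c (by rw [hca, hcb, hcc]; ring)]
    have := Real.sq_sqrt (by linarith : (0:ℝ) ≤ 2/3*(1-z))
    linarith
  have hneg : ∀ v : EuclideanSpace ℝ (Fin 3), dS v (-e) = dS v e := by
    intro v
    unfold dS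
    rw [inner_neg_right, neg_sq]
  have hJne : J a b c (-e) = J a b c e := by
    unfold J
    rw [hneg, hneg, hneg]
  have J0 : ∀ q, 0 ≤ J a b c q := fun q =>
    add_nonneg (add_nonneg (dS_nonneg _ _) (dS_nonneg _ _)) (dS_nonneg _ _)
  have main : ∀ q, ‖q‖ = 1 → J a b c q ≤ J a b c e → q = e ∨ q = -e := by
    intro q hq hJ
    have h1 := key a b c q z ha hb hc hq hab hac hbc hz0 hz1
      (by rw [← hJe]; exact pow_le_pow_left₀ (J0 q) hJ 2)
    have h2 : ⟪e, q⟫ = n⁻¹ * (⟪a, q⟫ + ⟪b, q⟫ + ⟪c, q⟫) := by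
      rw [he, real_inner_smul_left, inner_add_left, inner_add_left]
    have h3 : 1 ≤ ⟪e, q⟫^2 := by
      rw [h2, mul_pow, inv_pow, hn2]
      rw [← hn2] at *
      rw [inv_mul_eq_div, one_le_div (by positivity)]
      exact h1
    rcases le_total 0 ⟪e, q⟫ with h | h
    · left
      have h4 : 1 ≤ ⟪e, q⟫ := by nlinarith
      have h5 : ‖q - e‖^2 = 2 - 2*⟪e, q⟫ := by
        rw [norm_sub_sq_real, hq, hen, real_inner_comm]; ring
      have h6 : ‖q - e‖ = 0 := by
        have := sq_nonneg ‖q - e‖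
        exact pow_eq_zero_iff (two_ne_zero) |>.1 (by linarith)
      exact sub_eq_zero.1 (norm_eq_zero.1 h6)
    · right
      have h4 : ⟪e, q⟫ ≤ -1 := by nlinarith
      have h5 : ‖q + e‖^2 = 2 + 2*⟪e, q⟫ := by
        rw [norm_add_sq_real, hq, hen, real_inner_comm]; ring
      have h6 : ‖q + e‖ = 0 := by
        have := sq_nonneg ‖q + e‖
        exact pow_eq_zero_iff (two_ne_zero) |>.1 (by linarith)
      exact eq_neg_of_add_eq_zero_left (norm_eq_zero.1 h6)
  have emin : ∀ q, ‖q‖ = 1 → J a b c e ≤ J a b c q := by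
    intro q hq
    by_contra hcon
    push Not at hcon
    rcases main q hq hcon.le with h | h
    · rw [h] at hcon; exact lt_irrefl _ hcon
    · rw [h, hJne] at hcon; exact lt_irrefl _ hcon
  ext p
  simp only [Set.mem_setOf_eq, Set.mem_insert_iff, Set.mem_singleton_iff]
  constructor
  · rintro ⟨hp, hmin⟩
    exact main p hp (hmin e hen)
  · rintro (h | h)
    · rw [h]; exact ⟨hen, emin⟩
    · rw [h]; exact ⟨by rw [norm_neg]; exact hen, by rw [hJne]; exact emin⟩
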